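/- Let r be an integer. For any words ω₁, σ, ω₂ over the alphabet A such that |σ|_h + |σ|_H = r·|σ|_V, we have W(ω₁ · H · σ · h · ω₂) − W(ω₁ · h · σ · H · ω₂) = 2r, where · denotes concatenation of words and single letters. -/

import Mathlib

/-- The four-letter alphabet `A = {h, v, H, V}`. -/
inductive Letter : Type
  | h : Letter
  | v : Letter
  | H : Letter
  | V : Letter
deriving DecidableEq

/-- The pairwise weight `w : A × A → ℤ` with `w(x,x) = 0`, `w(x,y) = -w(y,x)`, and
`w(h,v) = w(H,v) = w(h,V) = 1`, `w(H,h) = r`, `w(v,V) = r`, `w(V,H) = r² - 1`. -/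
def pairWeight (r : ℤ) : Letter → Letter → ℤ
  | .h, .h => 0
  | .v, .v => 0
  | .H, .H => 0
  | .V, .V => 0
  | .h, .v => 1
  | .v, .h => -1
  | .H, .v => 1
  | .v, .H => -1
  | .h, .V => 1
  | .V, .h => -1
  | .H, .h => r
  | .h, .H => -r
  | .v, .V => r
  | .V, .v => -r
  | .V, .H => r ^ 2 - 1
  | .H, .V => 1 - r ^ 2

/-- The weight of a word `σ = σ_1 ⋯ σ_m` is `W(σ) = Σ_{1 ≤ i < j ≤ m} w(σ_i, σ_j)`. -/
def wordWeight (r : ℤ) : List Letter → ℤ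
  | [] => 0
  | a :: s => (s.map (pairWeight r a)).sum + wordWeight r s

/-- `cnt x σ` is the number of occurrences `|σ|_x` of the letter `x` in `σ`. -/
def cnt (x : Letter) (σ : List Letter) : ℕ :=
  (σ.filter fun y => y = x).length

theorem wordWeight_append (r : ℤ) (s t : List Letter) :
    wordWeight r (s ++ t) = wordWeight r s + wordWeight r t +
      (s.map fun a => (t.map (pairWeight r a)).sum).sum := by
  induction s with
  | nil => simp [wordWeight]
  | cons a s ih =>
    simp only [List.cons_append, wordWeight, List.map_append, List.sum_append, ih,
      List.map_cons, List.sum_cons]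
    ring

theorem pairWeight_swap (r : ℤ) (x y : Letter) : pairWeight r y x = -pairWeight r x y := by
  cases x <;> cases y <;> simp [pairWeight]

theorem sum_map_pairWeight_swap (r : ℤ) (x : Letter) (s : List Letter) :
    (s.map fun a => pairWeight r a x).sum = -(s.map (pairWeight r x)).sum := by
  induction s with
  | nil => simp
  | cons a s ih =>
    simp only [List.map_cons, List.sum_cons, ih, pairWeight_swap r x a]
    ring

theorem sum_map_pairWeight_H_sub_h (r : ℤ) (s : List Letter) :
    (s.map (pairWeight r .H)).sum - (s.map (pairWeight r .h)).sum =
      r * (cnt .h s + cnt .H s - r * cnt .V s) := by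
  induction s with
  | nil => simp [cnt]
  | cons a s ih =>
    simp only [cnt, List.map_cons, List.sum_cons] at ih ⊢
    cases a <;> simp [pairWeight] <;> linear_combination ih

/-- For any words `ω₁, σ, ω₂` over `A` with `|σ|_h + |σ|_H = r·|σ|_V`, we have
`W(ω₁ · H · σ · h · ω₂) − W(ω₁ · h · σ · H · ω₂) = 2r`. -/
theorem wordWeight_swap (r : ℤ) (ω₁ σ ω₂ : List Letter)
    (hσ : (cnt .h σ : ℤ) + (cnt .H σ : ℤ) = r * (cnt .V σ : ℤ)) :
    wordWeight r (ω₁ ++ [Letter.H] ++ σ ++ [Letter.h] ++ ω₂) -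
      wordWeight r (ω₁ ++ [Letter.h] ++ σ ++ [Letter.H] ++ ω₂) = 2 * r := by
  have key := sum_map_pairWeight_H_sub_h r σ
  rw [hσ, sub_self, mul_zero] at key
  simp only [wordWeight_append, wordWeight, List.map_append, List.sum_append, List.map_cons,
    List.map_nil, List.sum_cons, List.sum_nil, add_zero, sum_map_pairWeight_swap]
  simp only [pairWeight]
  linear_combination 2 * key
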